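/- Let (V, B) be a Steiner quadruple system with |V| = n ≥ 20, i.e., B is a family of 4-element subsets of V such that every 3-element subset of V is contained in exactly one member of B. Then (V, B) admits no non-crossing drawing by quadrilaterals in ℝ³: there do not exist an injective map p : V → ℝ³ and, for each block b ∈ B, a filled quadrilateral Q_b ⊆ ℝ³ with corner set p(b), such that Q_b ∩ Q_{b'} = p(b ∩ b') for all distinct blocks b, b' ∈ B. -/

import Mathlib

/-- `Q` is a filled quadrilateral with corner set `s`: `s` consists of four distinct
coplanar points which, for some labeling `a, b, c, d`, split `Q` into the two triangles
`conv {a, b, c}` and `conv {a, c, d}` meeting exactly in the segment `[a, c]`. -/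
def IsFilledQuadrilateral (Q s : Set (EuclideanSpace ℝ (Fin 3))) : Prop :=
  ∃ a b c d : EuclideanSpace ℝ (Fin 3),
    s = {a, b, c, d} ∧
    a ≠ b ∧ a ≠ c ∧ a ≠ d ∧ b ≠ c ∧ b ≠ d ∧ c ≠ d ∧
    Coplanar ℝ ({a, b, c, d} : Set (EuclideanSpace ℝ (Fin 3))) ∧
    AffineIndependent ℝ ![a, b, c] ∧ AffineIndependent ℝ ![a, c, d] ∧
    convexHull ℝ ({a, b, c} : Set (EuclideanSpace ℝ (Fin 3))) ∩
      convexHull ℝ ({a, c, d} : Set (EuclideanSpace ℝ (Fin 3))) = segment ℝ a c ∧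
    Q = convexHull ℝ ({a, b, c} : Set (EuclideanSpace ℝ (Fin 3))) ∪
      convexHull ℝ ({a, c, d} : Set (EuclideanSpace ℝ (Fin 3)))

/-- Of two pairs of corners of a filled quadrilateral sharing a corner, at least one spans a
segment contained in the quadrilateral. -/
theorem IsFilledQuadrilateral.segment_subset_or {Q s : Set (EuclideanSpace ℝ (Fin 3))}
    (h : IsFilledQuadrilateral Q s) {x y z : EuclideanSpace ℝ (Fin 3)}
    (hx : x ∈ s) (hy : y ∈ s) (hz : z ∈ s) (hxy : x ≠ y) (hxz : x ≠ z) (hyz : y ≠ z) :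
    segment ℝ x y ⊆ Q ∨ segment ℝ x z ⊆ Q := by
  obtain ⟨a, b, c, d, rfl, -, -, -, -, -, -, -, -, -, -, rfl⟩ := h
  have left : ∀ u ∈ ({a, b, c} : Set (EuclideanSpace ℝ (Fin 3))),
      ∀ v ∈ ({a, b, c} : Set (EuclideanSpace ℝ (Fin 3))),
      segment ℝ u v ⊆ convexHull ℝ {a, b, c} ∪ convexHull ℝ {a, c, d} := fun u hu v hv =>
    (segment_subset_convexHull hu hv).trans Set.subset_union_left
  have right : ∀ u ∈ ({a, c, d} : Set (EuclideanSpace ℝ (Fin 3))),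
      ∀ v ∈ ({a, c, d} : Set (EuclideanSpace ℝ (Fin 3))),
      segment ℝ u v ⊆ convexHull ℝ {a, b, c} ∪ convexHull ℝ {a, c, d} := fun u hu v hv =>
    (segment_subset_convexHull hu hv).trans Set.subset_union_right
  simp only [Set.mem_insert_iff, Set.mem_singleton_iff] at hx hy hz left right
  rcases hx with rfl | rfl | rfl | rfl <;> rcases hy with rfl | rfl | rfl | rfl <;>
    rcases hz with rfl | rfl | rfl | rfl <;> simp_all

/-- Two distinct blocks of a non-crossing drawing do not both contain the segment spanned by two
common vertices. -/
theorem not_segment_subset_of_inter_eq_image {V E : Type*} [DecidableEq V]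
    [AddCommGroup E] [Module ℝ E] {p : V → E} (hp : Function.Injective p) {b b' : Finset V}
    (hcard : (b ∩ b').card < 3) {Q Q' : Set E}
    (hQ : Q ∩ Q' = p '' ((b ∩ b' : Finset V) : Set V)) {x y : V} (hxy : x ≠ y)
    (hx : x ∈ b ∩ b') (hy : y ∈ b ∩ b') (h : segment ℝ (p x) (p y) ⊆ Q) :
    ¬ segment ℝ (p x) (p y) ⊆ Q' := by
  intro h'
  have hmid := midpoint_mem_segment (𝕜 := ℝ) (p x) (p y)
  have hm : midpoint ℝ (p x) (p y) ∈ Q ∩ Q' := ⟨h hmid, h' hmid⟩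
  rw [hQ] at hm
  obtain ⟨q, hq, hqm⟩ := hm
  have hqx : x ≠ q := fun e =>
    hxy (hp (midpoint_eq_left_iff ℝ |>.1 (hqm.symm.trans (congrArg p e.symm))))
  have hqy : y ≠ q := fun e =>
    hxy (hp (midpoint_eq_right_iff ℝ |>.1 (hqm.symm.trans (congrArg p e.symm))))
  have hsub : ({x, y, q} : Finset V) ⊆ b ∩ b' := by
    simp only [Finset.insert_subset_iff, Finset.singleton_subset_iff]
    exact ⟨hx, hy, hq⟩
  have := Finset.card_le_card hsub
  rw [Finset.card_eq_three.2 ⟨x, y, q, hxy, hqx, hqy, rfl⟩] at this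
  omega

/-- **second part of Theorem 6 of the paper.** No Steiner quadruple system
on at least 20 vertices admits a non-crossing drawing by (arbitrary filled)
quadrilaterals in ℝ³. -/
theorem large_sqs_no_quadrilateral_drawing
    {V : Type*} [Fintype V] [DecidableEq V] (n : ℕ) (hn : n = Fintype.card V)
    (hn20 : 20 ≤ n) (B : Finset (Finset V))
    (hcard : ∀ b ∈ B, b.card = 4)
    (hsteiner : ∀ t : Finset V, t.card = 3 → ∃! b, b ∈ B ∧ t ⊆ b) :
    ¬ ∃ (p : V → EuclideanSpace ℝ (Fin 3))
        (Q : Finset V → Set (EuclideanSpace ℝ (Fin 3))),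
      Function.Injective p ∧
      (∀ b ∈ B, IsFilledQuadrilateral (Q b) (p '' (b : Set V))) ∧
      (∀ b ∈ B, ∀ b' ∈ B, b ≠ b' →
        Q b ∩ Q b' = p '' ((b ∩ b' : Finset V) : Set V)) := by
  rintro ⟨p, Q, hp, hquad, hinter⟩
  have hcap : ∀ b ∈ B, ∀ b' ∈ B, b ≠ b' → (b ∩ b').card < 3 := by
    intro b hb b' hb' hne
    by_contra! hlt
    obtain ⟨t, ht, htc⟩ := Finset.exists_subset_card_eq hlt
    exact hne ((hsteiner t htc).unique ⟨hb, ht.trans Finset.inter_subset_left⟩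
      ⟨hb', ht.trans Finset.inter_subset_right⟩)
  have hnot : ∀ b ∈ B, ∀ b' ∈ B, b ≠ b' → ∀ x y, x ≠ y → x ∈ b → x ∈ b' → y ∈ b → y ∈ b' →
      segment ℝ (p x) (p y) ⊆ Q b → ¬ segment ℝ (p x) (p y) ⊆ Q b' :=
    fun b hb b' hb' hne x y hxy hx hx' hy hy' =>
      not_segment_subset_of_inter_eq_image hp (hcap b hb b' hb' hne) (hinter b hb b' hb' hne) hxy
        (Finset.mem_inter.2 ⟨hx, hx'⟩) (Finset.mem_inter.2 ⟨hy, hy'⟩)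
  have hor : ∀ b ∈ B, ∀ x ∈ b, ∀ y ∈ b, ∀ z ∈ b, x ≠ y → x ≠ z → y ≠ z →
      segment ℝ (p x) (p y) ⊆ Q b ∨ segment ℝ (p x) (p z) ⊆ Q b :=
    fun b hb x hx y hy z hz hxy hxz hyz =>
      (hquad b hb).segment_subset_or (Set.mem_image_of_mem p hx) (Set.mem_image_of_mem p hy)
        (Set.mem_image_of_mem p hz) (hp.ne hxy) (hp.ne hxz) (hp.ne hyz)
  have hblock : ∀ x y z, x ≠ y → x ≠ z → y ≠ z → ∃ b ∈ B, x ∈ b ∧ y ∈ b ∧ z ∈ b := by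
    intro x y z hxy hxz hyz
    obtain ⟨b, ⟨hb, hsub⟩, -⟩ :=
      hsteiner {x, y, z} (Finset.card_eq_three.2 ⟨x, y, z, hxy, hxz, hyz, rfl⟩)
    simp only [Finset.insert_subset_iff, Finset.singleton_subset_iff] at hsub
    exact ⟨b, hb, hsub⟩
  have hdiff : ∀ b ∈ B, ∀ b' ∈ B, b ≠ b' → ∃ z ∈ b, z ∉ b' := by
    intro b hb b' hb' hne
    refine Finset.not_subset.1 fun hsub => hne (Finset.eq_of_subset_of_card_le hsub ?_)
    rw [hcard b hb, hcard b' hb']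
  have hmiss : ∀ b ∈ B, ∀ b' ∈ B, b ≠ b' → ∀ x y, x ≠ y → x ∈ b → x ∈ b' → y ∈ b → y ∈ b' →
      segment ℝ (p x) (p y) ⊆ Q b ∨ segment ℝ (p x) (p y) ⊆ Q b' := by
    intro b hb b' hb' hne x y hxy hx hx' hy hy'
    by_contra! hcon
    obtain ⟨z, hz, hz'⟩ := hdiff b hb b' hb' hne
    obtain ⟨w, hw', hw⟩ := hdiff b' hb' b hb hne.symm
    have hxz : x ≠ z := fun e => hz' (e ▸ hx')
    have hyz : y ≠ z := fun e => hz' (e ▸ hy')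
    have hxw : x ≠ w := fun e => hw (e ▸ hx)
    have hyw : y ≠ w := fun e => hw (e ▸ hy)
    have hzw : z ≠ w := fun e => hw (e ▸ hz)
    obtain ⟨c, hc, hxc, hzc, hwc⟩ := hblock x z w hxz hxw hzw
    have hsz := (hor b hb x hx y hy z hz hxy hxz hyz).resolve_left hcon.1
    have hsw := (hor b' hb' x hx' y hy' w hw' hxy hxw hyw).resolve_left hcon.2
    rcases hor c hc x hxc z hzc w hwc hxz hxw hzw with h | h
    · exact hnot b hb c hc (fun e => hw (e ▸ hwc)) x z hxz hx hxc hz hzc hsz h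
    · exact hnot b' hb' c hc (fun e => hz' (e ▸ hzc)) x w hxw hx' hxc hw' hwc hsw h
  have houtside : ∀ s : Finset V, s.card < 20 → ∃ z, z ∉ s := by
    intro s hs
    by_contra! hall
    have := Finset.card_eq_iff_eq_univ s |>.2 (Finset.eq_univ_iff_forall.2 hall)
    omega
  obtain ⟨x, -⟩ := houtside ∅ (by simp)
  obtain ⟨y, hy⟩ := houtside {x} (by simp)
  have hxy : x ≠ y := fun e => hy (by simp [e])
  have hthrough : ∀ s : Finset V, s.card < 18 → ∃ b ∈ B, x ∈ b ∧ y ∈ b ∧ ∃ z ∈ b, z ∉ s := by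
    intro s hs
    obtain ⟨z, hz⟩ := houtside (insert x (insert y s)) (by
      have := Finset.card_insert_le x (insert y s)
      have := Finset.card_insert_le y s
      omega)
    simp only [Finset.mem_insert, not_or] at hz
    obtain ⟨b, hb, hxb, hyb, hzb⟩ := hblock x y z hxy (Ne.symm hz.1) (Ne.symm hz.2.1)
    exact ⟨b, hb, hxb, hyb, z, hzb, hz.2.2⟩
  obtain ⟨b₁, hb₁, hx₁, hy₁, -⟩ := hthrough ∅ (by simp)
  obtain ⟨b₂, hb₂, hx₂, hy₂, z₂, hz₂, hz₂'⟩ := hthrough b₁ (by rw [hcard b₁ hb₁]; norm_num)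
  obtain ⟨b₃, hb₃, hx₃, hy₃, z₃, hz₃, hz₃'⟩ := hthrough (b₁ ∪ b₂) (by
    have := Finset.card_union_le b₁ b₂
    rw [hcard b₁ hb₁, hcard b₂ hb₂] at this
    omega)
  rw [Finset.mem_union, not_or] at hz₃'
  have h₁₂ : b₁ ≠ b₂ := fun e => hz₂' (e ▸ hz₂)
  have h₁₃ : b₁ ≠ b₃ := fun e => hz₃'.1 (e ▸ hz₃)
  have h₂₃ : b₂ ≠ b₃ := fun e => hz₃'.2 (e ▸ hz₃)
  have m₁₂ := hmiss b₁ hb₁ b₂ hb₂ h₁₂ x y hxy hx₁ hx₂ hy₁ hy₂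
  have m₁₃ := hmiss b₁ hb₁ b₃ hb₃ h₁₃ x y hxy hx₁ hx₃ hy₁ hy₃
  have m₂₃ := hmiss b₂ hb₂ b₃ hb₃ h₂₃ x y hxy hx₂ hx₃ hy₂ hy₃
  have n₁₂ := hnot b₁ hb₁ b₂ hb₂ h₁₂ x y hxy hx₁ hx₂ hy₁ hy₂
  have n₁₃ := hnot b₁ hb₁ b₃ hb₃ h₁₃ x y hxy hx₁ hx₃ hy₁ hy₃
  have n₂₃ := hnot b₂ hb₂ b₃ hb₃ h₂₃ x y hxy hx₂ hx₃ hy₂ hy₃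
  tauto
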